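/- arXiv:2003.04448 — 6 statements merged into one kernel-verified Lean document; each statement's English description precedes it below -/
import Mathlib

section
/- Let n ≥ 2 and d ≥ 2, let X be a topological space, and let g : (Fin n → EuclideanSpace ℝ (Fin d)) → X be a continuous map that is permutation-invariant, i.e. g (v ∘ σ) = g v for every tuple v and every permutation σ : Equiv.Perm (Fin n). Suppose h : X → (Fin n → EuclideanSpace ℝ (Fin d)) satisfies: for every injective tuple v : Fin n → EuclideanSpace ℝ (Fin d) there exists a permutation σ : Equiv.Perm (Fin n) with h (g v) = v ∘ σ. Then h is not continuous. -/
/-- If a continuous family of tuples is, at every parameter, a reordering of a continuous family of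
injective tuples, then over a preconnected parameter space the reordering can be chosen constant. -/
theorem exists_perm_forall_eq_comp_of_continuous {T ι E : Type*} [TopologicalSpace T]
    [PreconnectedSpace T] [Nonempty T] [Finite ι] [TopologicalSpace E] [T2Space E]
    {γ δ : T → ι → E} (hγ : Continuous γ) (hδ : Continuous δ)
    (hinj : ∀ t, Function.Injective (γ t))
    (hperm : ∀ t, ∃ σ : Equiv.Perm ι, δ t = γ t ∘ σ) :
    ∃ σ : Equiv.Perm ι, ∀ t, δ t = γ t ∘ σ := by
  have hclosed (σ : Equiv.Perm ι) : IsClosed {t | δ t = γ t ∘ σ} :=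
    isClosed_eq hδ (by simp only [Function.comp_def]; fun_prop)
  have hcompl (σ : Equiv.Perm ι) :
      {t | δ t = γ t ∘ σ}ᶜ = ⋃ τ ∈ ({σ}ᶜ : Set (Equiv.Perm ι)), {t | δ t = γ t ∘ τ} := by
    ext t
    simp only [Set.mem_compl_iff, Set.mem_ofPred_eq, Set.mem_iUnion, Set.mem_singleton_iff,
      exists_prop]
    constructor
    · intro ht
      obtain ⟨τ, hτ⟩ := hperm t
      exact ⟨τ, fun h => ht (h ▸ hτ), hτ⟩
    · rintro ⟨τ, hne, hτ⟩ ht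
      exact hne (DFunLike.coe_injective ((hinj t).comp_left (hτ.symm.trans ht)))
  obtain ⟨t₀⟩ := ‹Nonempty T›
  obtain ⟨σ, hσ⟩ := hperm t₀
  have hclopen : IsClopen {t | δ t = γ t ∘ σ} := by
    refine ⟨hclosed σ, isClosed_compl_iff.mp ?_⟩
    rw [hcompl]
    exact (Set.toFinite _).isClosed_biUnion fun τ _ => hclosed τ
  have huniv := hclopen.eq_univ ⟨t₀, hσ⟩
  exact ⟨σ, fun t => huniv.ge (Set.mem_univ t)⟩

/-- A line of `n` distinct points, symmetric about the origin, can be rotated by half a turn, which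
reverses the order of its points. -/
theorem exists_continuous_injective_reversal (n d : ℕ) (hd : 2 ≤ d) :
    ∃ γ : ℝ → Fin n → EuclideanSpace ℝ (Fin d), Continuous γ ∧
      (∀ t, Function.Injective (γ t)) ∧ γ Real.pi = γ 0 ∘ Fin.revPerm := by
  let i₀ : Fin d := ⟨0, by omega⟩
  let i₁ : Fin d := ⟨1, by omega⟩
  let u (t : ℝ) : EuclideanSpace ℝ (Fin d) :=
    Real.cos t • EuclideanSpace.single i₀ 1 + Real.sin t • EuclideanSpace.single i₁ 1
  have hne : i₀ ≠ i₁ := by simp [i₀, i₁]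
  have hu (t : ℝ) : u t ≠ 0 := by
    intro h
    have hcos : Real.cos t = 0 := by simpa [u, hne] using congrArg (fun x => x i₀) h
    have hsin : Real.sin t = 0 := by simpa [u, hne.symm] using congrArg (fun x => x i₁) h
    simpa [hcos, hsin] using Real.sin_sq_add_cos_sq t
  refine ⟨fun t i => (2 * (i : ℝ) + 1 - n) • u t, by fun_prop, fun t i j hij => ?_, ?_⟩
  · have := smul_left_injective ℝ (hu t) hij
    exact Fin.ext (by exact_mod_cast (by linarith : (i : ℝ) = j))
  · funext i
    have hrev : ((i.rev : ℕ) : ℝ) = n - (i + 1) := by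
      rw [Fin.val_rev, Nat.cast_sub i.isLt]
      push_cast
      rfl
    simp only [Function.comp_apply, Fin.revPerm_apply, hrev, u, Real.cos_pi, Real.sin_pi,
      Real.cos_zero, Real.sin_zero]
    module


/-- The responsibility problem (Theorem 1 of the paper): if `g` is a continuous,
permutation-invariant generator of inputs from latent tuples of entities, and `h`
recovers from `g`'s output a listing of the entities (up to permutation) on all
injective tuples, then `h` must be discontinuous. -/
theorem responsibility_problem (n d : ℕ) (hn : 2 ≤ n) (hd : 2 ≤ d)
    (X : Type*) [TopologicalSpace X]
    (g : (Fin n → EuclideanSpace ℝ (Fin d)) → X)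
    (hg : Continuous g)
    (hginv : ∀ (v : Fin n → EuclideanSpace ℝ (Fin d)) (σ : Equiv.Perm (Fin n)),
      g (v ∘ σ) = g v)
    (h : X → (Fin n → EuclideanSpace ℝ (Fin d)))
    (hh : ∀ v : Fin n → EuclideanSpace ℝ (Fin d), Function.Injective v →
      ∃ σ : Equiv.Perm (Fin n), h (g v) = v ∘ σ) :
    ¬ Continuous h := by
  intro hcont
  obtain ⟨γ, hγ, hinj, hrev⟩ := exists_continuous_injective_reversal n d hd
  obtain ⟨σ, hσ⟩ := exists_perm_forall_eq_comp_of_continuous hγ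
    (hcont.comp (hg.comp hγ)) hinj fun t => hh (γ t) (hinj t)
  have heq : γ 0 ∘ (Fin.revPerm ∘ σ) = γ 0 ∘ σ := by
    rw [← Function.comp_assoc, ← hrev, ← hσ, ← hσ]
    simp only [Function.comp_apply, hrev, hginv]
  have hfix := congrFun ((hinj 0).comp_left heq) (σ.symm ⟨0, by omega⟩)
  simp [Fin.ext_iff] at hfix
  omega
end

section
/- Let n ≥ 2 and d ≥ 2. Consider the setoid on Fin n → EuclideanSpace ℝ (Fin d) that relates v and w if and only if there exists a permutation σ : Equiv.Perm (Fin n) with w = v ∘ σ, and equip the quotient Q of (Fin n → EuclideanSpace ℝ (Fin d)) by this setoid with the quotient topology. Then there is no continuous map s : Q → (Fin n → EuclideanSpace ℝ (Fin d)) such that Quotient.mk (s q) = q for every q ∈ Q. -/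
/-- The setoid on tuples relating two tuples iff one is a permutation of the other. -/
def permSetoid (n d : ℕ) : Setoid (Fin n → EuclideanSpace ℝ (Fin d)) where
  r v w := ∃ σ : Equiv.Perm (Fin n), w = v ∘ σ
  iseqv := by
    constructor
    · intro v
      exact ⟨1, by ext i; simp⟩
    · rintro v w ⟨σ, rfl⟩
      exact ⟨σ⁻¹, by ext i; simp⟩
    · rintro u v w ⟨σ, rfl⟩ ⟨τ, rfl⟩
      exact ⟨σ * τ, by ext i; simp [Equiv.Perm.mul_apply]⟩

/-- Along a connected family of injective tuples, a continuous section of the quotient map lists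
the entries in an order that does not change, so the family cannot permute the entries of a
tuple nontrivially. -/
theorem eq_of_mk_eq_of_continuous_section {n d : ℕ}
    {s : Quotient (permSetoid n d) → (Fin n → EuclideanSpace ℝ (Fin d))} (hs : Continuous s)
    (hsec : ∀ q, Quotient.mk (permSetoid n d) (s q) = q)
    {X : Type*} [TopologicalSpace X] [PreconnectedSpace X]
    {v : X → Fin n → EuclideanSpace ℝ (Fin d)} (hv : Continuous v)
    (hinj : ∀ x, Function.Injective (v x)) {a b : X}
    (hab : Quotient.mk (permSetoid n d) (v a) = Quotient.mk (permSetoid n d) (v b)) :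
    v a = v b := by
  have hex (x : X) : ∃ σ : Equiv.Perm (Fin n),
      s (Quotient.mk (permSetoid n d) (v x)) = v x ∘ σ :=
    Quotient.exact (hsec (Quotient.mk (permSetoid n d) (v x))).symm
  choose σ hσ using hex
  have hpre (τ : Equiv.Perm (Fin n)) :
      σ ⁻¹' {τ} = {x | s (Quotient.mk (permSetoid n d) (v x)) = v x ∘ τ} := by
    ext x
    refine ⟨fun h => ?_, fun h => ?_⟩
    · obtain rfl : σ x = τ := h
      exact hσ x
    · exact Equiv.ext fun i => hinj x (congrFun ((hσ x).symm.trans h) i)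
  have hclosed (τ : Equiv.Perm (Fin n)) : IsClosed (σ ⁻¹' {τ}) := by
    rw [hpre]
    refine isClosed_eq (hs.comp (continuous_quotient_mk'.comp hv)) ?_
    exact continuous_pi fun i => (continuous_apply (τ i)).comp hv
  let _ : TopologicalSpace (Equiv.Perm (Fin n)) := ⊥
  have : DiscreteTopology (Equiv.Perm (Fin n)) := ⟨rfl⟩
  have hcont : Continuous σ := continuous_iff_isClosed.2 fun t _ => by
    rw [← Set.biUnion_preimage_singleton]
    exact t.toFinite.isClosed_biUnion fun τ _ => hclosed τ
  have hconst : σ a = σ b := PreconnectedSpace.constant ‹_› hcont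
  refine (σ a).surjective.injective_comp_right ?_
  calc v a ∘ σ a = v b ∘ σ b := by rw [← hσ a, hab, hσ b]
    _ = v b ∘ σ a := by rw [hconst]

/-- The tuple of complex numbers `(z, -z, 2, 3, …, n - 1)`. -/
noncomputable def antipodalTuple (n : ℕ) (z : ℂ) (i : Fin n) : ℂ :=
  if (i : ℕ) = 0 then z else if (i : ℕ) = 1 then -z else (i : ℕ)

theorem continuous_antipodalTuple (n : ℕ) : Continuous (antipodalTuple n) := by
  refine continuous_pi fun i => ?_
  unfold antipodalTuple
  split_ifs <;> fun_prop

theorem antipodalTuple_injective (n : ℕ) {z : ℂ} (hz : ‖z‖ = 1) :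
    Function.Injective (antipodalTuple n z) := by
  have hz0 : z ≠ 0 := norm_ne_zero_iff.1 (by simp [hz])
  have hne (k : ℕ) (hk : k ≠ 1) : z ≠ k ∧ -z ≠ k := by
    constructor <;> intro h <;> have h' := congrArg norm h <;> simp [hz] at h' <;>
      exact hk (mod_cast h'.symm)
  intro i j h
  unfold antipodalTuple at h
  apply Fin.ext
  have hz1 : z ≠ -z := self_ne_neg.2 hz0
  split_ifs at h <;> first | omega | exact mod_cast h | grind

theorem antipodalTuple_neg {n : ℕ} (hn : 2 ≤ n) (z : ℂ) :
    antipodalTuple n (-z) =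
      antipodalTuple n z ∘ Equiv.swap (⟨0, by omega⟩ : Fin n) ⟨1, by omega⟩ := by
  ext i
  simp only [Function.comp_apply, Equiv.swap_apply_def, antipodalTuple, Fin.ext_iff]
  split_ifs <;> simp_all

/-- The inclusion of the plane as the first two coordinates. -/
noncomputable def planeInclusion {d : ℕ} (hd : 2 ≤ d) (z : ℂ) : EuclideanSpace ℝ (Fin d) :=
  z.re • EuclideanSpace.single ⟨0, by omega⟩ 1 + z.im • EuclideanSpace.single ⟨1, by omega⟩ 1

theorem continuous_planeInclusion {d : ℕ} (hd : 2 ≤ d) : Continuous (planeInclusion hd) := by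
  unfold planeInclusion
  fun_prop

theorem planeInclusion_injective {d : ℕ} (hd : 2 ≤ d) :
    Function.Injective (planeInclusion hd) := by
  intro z w h
  have h0 := congrArg (fun x => x ⟨0, by omega⟩) h
  have h1 := congrArg (fun x => x ⟨1, by omega⟩) h
  exact Complex.ext (by simpa [planeInclusion] using h0) (by simpa [planeInclusion] using h1)

/-- The quotient map from ordered tuples to unordered collections admits no
continuous section. -/
theorem no_continuous_section (n d : ℕ) (hn : 2 ≤ n) (hd : 2 ≤ d) :
    ¬ ∃ s : Quotient (permSetoid n d) → (Fin n → EuclideanSpace ℝ (Fin d)),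
        Continuous s ∧ ∀ q, Quotient.mk (permSetoid n d) (s q) = q := by
  rintro ⟨s, hs, hsec⟩
  let v (t : ℝ) (i : Fin n) : EuclideanSpace ℝ (Fin d) :=
    planeInclusion hd (antipodalTuple n (Complex.exp (t * Complex.I)) i)
  have hv : Continuous v := continuous_pi fun i =>
    (continuous_planeInclusion hd).comp
      ((continuous_apply i).comp ((continuous_antipodalTuple n).comp (by fun_prop)))
  have hinj (t : ℝ) : Function.Injective (v t) :=
    (planeInclusion_injective hd).comp
      (antipodalTuple_injective n (Complex.norm_exp_ofReal_mul_I t))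
  have hmk : Quotient.mk (permSetoid n d) (v 0) = Quotient.mk (permSetoid n d) (v Real.pi) := by
    refine Quotient.sound ⟨Equiv.swap ⟨0, by omega⟩ ⟨1, by omega⟩, funext fun i => ?_⟩
    simpa [v] using congrArg (planeInclusion hd) (congrFun (antipodalTuple_neg hn 1) i)
  have h := eq_of_mk_eq_of_continuous_section hs hsec hv hinj hmk
  have h0 := planeInclusion_injective hd (congrFun h ⟨0, by omega⟩)
  norm_num [antipodalTuple] at h0
end

section
/- Let n ≥ 1, d ≥ 1, and let A be a subset of Fin n → EuclideanSpace ℝ (Fin d). Suppose there exist a continuous path γ : unitInterval → (Fin n → EuclideanSpace ℝ (Fin d)) with γ t ∈ A and γ t injective for every t, and a permutation σ : Equiv.Perm (Fin n) with γ 1 = γ 0 ∘ σ and γ 0 ∘ σ ≠ γ 0. Let X be a topological space, let g : (Fin n → EuclideanSpace ℝ (Fin d)) → X be continuous and permutation-invariant (g (v ∘ τ) = g v for all v and τ), and let h : X → (Fin n → EuclideanSpace ℝ (Fin d)) satisfy: for every v ∈ A there exists a permutation τ : Equiv.Perm (Fin n) with h (g v) = v ∘ τ. Then h is not continuous. -/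
/-- Over a connected space, a continuous relabelling of a continuous family of injective
configurations is given by a single permutation. -/
theorem exists_perm_forall_eq_comp {T E ι : Type*} [TopologicalSpace T] [ConnectedSpace T]
    [TopologicalSpace E] [T2Space E] [Finite ι] {γ f : T → ι → E}
    (hγ : Continuous γ) (hγinj : ∀ t, Function.Injective (γ t)) (hf : Continuous f)
    (hfγ : ∀ t, ∃ τ : Equiv.Perm ι, f t = γ t ∘ τ) :
    ∃ τ : Equiv.Perm ι, ∀ t, f t = γ t ∘ τ := by
  choose τ hτ using hfγ
  have hpre : ∀ ρ : Equiv.Perm ι, τ ⁻¹' {ρ} = {t | f t = γ t ∘ ρ} := by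
    intro ρ
    ext t
    refine ⟨fun ht => ?_, fun ht => ?_⟩
    · rw [← show τ t = ρ from ht]
      exact hτ t
    · exact DFunLike.coe_injective ((hγinj t).comp_left ((hτ t).symm.trans ht))
  have hclosed : ∀ ρ : Equiv.Perm ι, IsClosed (τ ⁻¹' {ρ}) := fun ρ => by
    rw [hpre]
    exact isClosed_eq hf (by fun_prop)
  have hloc : IsLocallyConstant τ := fun s => by
    rw [← isClosed_compl_iff, ← Set.preimage_compl, ← Set.biUnion_preimage_singleton]
    exact (Set.toFinite _).isClosed_biUnion fun ρ _ => hclosed ρ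
  obtain ⟨t₀⟩ := (inferInstance : Nonempty T)
  exact ⟨τ t₀, fun t => by rw [hτ t, hloc.apply_eq_of_preconnectedSpace t t₀]⟩


/-- Generalization 1 of the responsibility problem: it suffices that the restricted
domain `A` contains a continuous curve of injective configurations connecting some
configuration to a genuinely permuted copy of itself. -/
theorem responsibility_problem_restricted (n d : ℕ) (hn : 1 ≤ n) (hd : 1 ≤ d)
    (A : Set (Fin n → EuclideanSpace ℝ (Fin d)))
    (γ : unitInterval → (Fin n → EuclideanSpace ℝ (Fin d)))
    (hγ : Continuous γ)
    (hγA : ∀ t, γ t ∈ A)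
    (hγinj : ∀ t, Function.Injective (γ t))
    (σ : Equiv.Perm (Fin n))
    (hσ : γ 1 = γ 0 ∘ σ)
    (hσne : γ 0 ∘ σ ≠ γ 0)
    (X : Type*) [TopologicalSpace X]
    (g : (Fin n → EuclideanSpace ℝ (Fin d)) → X)
    (hg : Continuous g)
    (hginv : ∀ (v : Fin n → EuclideanSpace ℝ (Fin d)) (τ : Equiv.Perm (Fin n)),
      g (v ∘ τ) = g v)
    (h : X → (Fin n → EuclideanSpace ℝ (Fin d)))
    (hh : ∀ v ∈ A, ∃ τ : Equiv.Perm (Fin n), h (g v) = v ∘ τ) :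
    ¬ Continuous h := by
  intro hcont
  obtain ⟨τ, hτ⟩ := exists_perm_forall_eq_comp (f := fun t => h (g (γ t))) hγ hγinj
    (hcont.comp (hg.comp hγ)) fun t => hh _ (hγA t)
  have hends : (γ 0 ∘ σ) ∘ τ = γ 0 ∘ τ := by
    rw [← hσ, ← hτ 1, ← hτ 0, hσ, hginv]
  exact hσne (τ.surjective.injective_comp_right hends)
end

section
/- Let T be a preconnected topological space, E a Hausdorff topological space, and n ≥ 1. Let γ, F : T → (Fin n → E) be continuous maps such that γ t is injective for every t, and such that for every t there exists a permutation τ : Equiv.Perm (Fin n) with F t = γ t ∘ τ. Then there exists a single permutation τ : Equiv.Perm (Fin n) such that F t = γ t ∘ τ for every t ∈ T. -/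
/-- A map to a finite type whose fibers are closed is locally constant. -/
theorem IsLocallyConstant.of_isClosed_fiber {X Y : Type*} [TopologicalSpace X] [Finite Y]
    {f : X → Y} (hf : ∀ y, IsClosed (f ⁻¹' {y})) : IsLocallyConstant f := by
  intro s
  rw [← isClosed_compl_iff, ← Set.preimage_compl, ← Set.biUnion_preimage_singleton]
  exact sᶜ.toFinite.isClosed_biUnion fun y _ => hf y

/-- Monodromy-type lemma: over a preconnected parameter space, a continuous family of
ordered listings of a continuously varying injective configuration uses a single
permutation throughout. -/
theorem single_permutation_of_preconnected (T : Type*) [TopologicalSpace T]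
    [PreconnectedSpace T] (E : Type*) [TopologicalSpace E] [T2Space E]
    (n : ℕ) (hn : 1 ≤ n)
    (γ F : T → (Fin n → E)) (hγ : Continuous γ) (hF : Continuous F)
    (hinj : ∀ t, Function.Injective (γ t))
    (hmatch : ∀ t, ∃ τ : Equiv.Perm (Fin n), F t = γ t ∘ τ) :
    ∃ τ : Equiv.Perm (Fin n), ∀ t, F t = γ t ∘ τ := by
  choose f hf using hmatch
  have hfiber (τ : Equiv.Perm (Fin n)) : f ⁻¹' {τ} = {t | F t = γ t ∘ τ} := by
    ext t
    refine ⟨fun h => h ▸ hf t, fun h => ?_⟩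
    exact DFunLike.coe_injective ((hinj t).comp_left ((hf t).symm.trans h))
  have hloc : IsLocallyConstant f := .of_isClosed_fiber fun τ => by
    rw [hfiber]
    exact isClosed_eq hF (by fun_prop)
  obtain ⟨τ, hτ⟩ := hloc.exists_eq_const
  exact ⟨τ, fun t => by rw [hf t, hτ, Function.const_apply]⟩
end

section
/- Let T be a topological space, E a Hausdorff topological space, and n ≥ 1. Let γ, F : T → (Fin n → E) be continuous maps such that γ t is injective for every t, and such that for every t there exists a permutation τ : Equiv.Perm (Fin n) with F t = γ t ∘ τ. Then for every fixed permutation τ₀ : Equiv.Perm (Fin n), the set {t ∈ T | F t = γ t ∘ τ₀} is open in T. -/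
/-- Local-constancy lemma: the set of parameters where a fixed permutation matches
the listing `F` to the injective configuration `γ` is open. -/
theorem matching_set_isOpen (T : Type*) [TopologicalSpace T]
    (E : Type*) [TopologicalSpace E] [T2Space E]
    (n : ℕ) (hn : 1 ≤ n)
    (γ F : T → (Fin n → E)) (hγ : Continuous γ) (hF : Continuous F)
    (hinj : ∀ t, Function.Injective (γ t))
    (hmatch : ∀ t, ∃ τ : Equiv.Perm (Fin n), F t = γ t ∘ τ)
    (τ₀ : Equiv.Perm (Fin n)) :
    IsOpen {t : T | F t = γ t ∘ τ₀} := by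
  have hset : {t : T | F t = γ t ∘ τ₀} =
      (⋃ τ ∈ {τ : Equiv.Perm (Fin n) | τ ≠ τ₀}, {t : T | F t = γ t ∘ τ})ᶜ := by
    ext t
    simp only [Set.mem_ofPred_eq, Set.mem_compl_iff, Set.mem_iUnion, exists_prop, not_exists,
      not_and]
    constructor
    · intro h₀ τ hτ h
      exact hτ (DFunLike.coe_injective ((hinj t).comp_left (h.symm.trans h₀)))
    · intro h
      obtain ⟨τ, hτ⟩ := hmatch t
      by_cases hne : τ = τ₀
      · rwa [← hne]
      · exact absurd hτ (h τ hne)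
  rw [hset, isOpen_compl_iff]
  refine (Set.toFinite _).isClosed_biUnion fun τ _ => isClosed_eq hF ?_
  exact continuous_pi fun i => (continuous_apply (τ i)).comp hγ
end

section
/- Let n ≥ 2 and d ≥ 2. Let C be the subtype {v : Fin n → EuclideanSpace ℝ (Fin d) // Function.Injective v} of injective tuples, with the subspace topology, and consider the setoid on C relating u and w if and only if there exists a permutation σ : Equiv.Perm (Fin n) with (w : Fin n → EuclideanSpace ℝ (Fin d)) = (u : Fin n → EuclideanSpace ℝ (Fin d)) ∘ σ. Equip the quotient Q of C by this setoid with the quotient topology. Then there is no continuous map s : Q → C such that Quotient.mk (s q) = q for every q ∈ Q. -/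
/-- The setoid on injective tuples relating two tuples iff one is a permutation of
the other. -/
def permSetoidInj (n d : ℕ) :
    Setoid {v : Fin n → EuclideanSpace ℝ (Fin d) // Function.Injective v} where
  r u w := ∃ σ : Equiv.Perm (Fin n),
    (w : Fin n → EuclideanSpace ℝ (Fin d)) = (u : Fin n → EuclideanSpace ℝ (Fin d)) ∘ σ
  iseqv := by
    constructor
    · intro u
      exact ⟨1, by ext i; simp⟩
    · rintro ⟨u, hu⟩ ⟨w, hw⟩ ⟨σ, h⟩
      exact ⟨σ⁻¹, by subst h; ext i; simp⟩
    · rintro ⟨u, hu⟩ ⟨v, hv⟩ ⟨w, hw⟩ ⟨σ, h₁⟩ ⟨τ, h₂⟩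
      exact ⟨σ * τ, by subst h₁; subst h₂; ext i; simp [Equiv.Perm.mul_apply]⟩

/-- Along a continuous family of injective tuples over a connected base, a continuous section
of the projection to unordered configurations reorders by one fixed permutation. -/
theorem exists_perm_forall_section_eq {n d : ℕ} {X : Type*} [TopologicalSpace X]
    [ConnectedSpace X]
    {s : Quotient (permSetoidInj n d) →
      {v : Fin n → EuclideanSpace ℝ (Fin d) // Function.Injective v}}
    (hs : Continuous s) (hsec : ∀ q, Quotient.mk (permSetoidInj n d) (s q) = q)
    {f : X → {v : Fin n → EuclideanSpace ℝ (Fin d) // Function.Injective v}}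
    (hf : Continuous f) :
    ∃ σ : Equiv.Perm (Fin n), ∀ x,
      (s (Quotient.mk (permSetoidInj n d) (f x))).1 = (f x).1 ∘ σ := by
  let A : Equiv.Perm (Fin n) → Set X :=
    fun σ => {x | (s (Quotient.mk (permSetoidInj n d) (f x))).1 = (f x).1 ∘ σ}
  have hcover (x : X) : ∃ σ, x ∈ A σ :=
    Quotient.exact (hsec (Quotient.mk (permSetoidInj n d) (f x))).symm
  have hunique {x : X} {σ τ : Equiv.Perm (Fin n)} (hxσ : x ∈ A σ) (hxτ : x ∈ A τ) : σ = τ := by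
    ext1 i
    exact (f x).2 (congrFun (hxσ.symm.trans hxτ) i)
  have hclosed (σ : Equiv.Perm (Fin n)) : IsClosed (A σ) := by
    refine isClosed_eq (continuous_subtype_val.comp (hs.comp (continuous_quotient_mk'.comp hf))) ?_
    exact continuous_pi fun i => (continuous_apply (σ i)).comp (continuous_subtype_val.comp hf)
  have hcompl (σ : Equiv.Perm (Fin n)) : (A σ)ᶜ = ⋃ τ ∈ {τ | τ ≠ σ}, A τ := by
    ext x
    simp only [Set.mem_compl_iff, Set.mem_iUnion, Set.mem_ofPred_eq, exists_prop]
    constructor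
    · intro hx
      obtain ⟨τ, hτ⟩ := hcover x
      exact ⟨τ, fun h => hx (h ▸ hτ), hτ⟩
    · rintro ⟨τ, hne, hτ⟩ hσ
      exact hne (hunique hτ hσ)
  have hopen (σ : Equiv.Perm (Fin n)) : IsOpen (A σ) := by
    rw [← isClosed_compl_iff, hcompl]
    exact (Set.toFinite _).isClosed_biUnion fun τ _ => hclosed τ
  obtain ⟨x₀⟩ := (inferInstance : Nonempty X)
  obtain ⟨σ, hσ⟩ := hcover x₀
  have huniv : A σ = Set.univ := IsClopen.eq_univ ⟨hclosed σ, hopen σ⟩ ⟨x₀, hσ⟩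
  exact ⟨σ, fun x => (huniv ▸ Set.mem_univ x : x ∈ A σ)⟩

/-- The tuple whose first two entries are antipodal points of the unit circle in the plane of
the coordinates `a` and `b`, at angles `t` and `t + π`, and whose `i`-th entry for `2 ≤ i` is
`i` times the basis vector of the coordinate `a`. -/
noncomputable def rotatingTuple (n : ℕ) {d : ℕ} (a b : Fin d) (t : ℝ) :
    Fin n → EuclideanSpace ℝ (Fin d) := fun i =>
  if (i : ℕ) = 0 then
    Real.cos t • EuclideanSpace.single a 1 + Real.sin t • EuclideanSpace.single b 1
  else if (i : ℕ) = 1 then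
    -(Real.cos t • EuclideanSpace.single a 1 + Real.sin t • EuclideanSpace.single b 1)
  else (i : ℝ) • EuclideanSpace.single a 1

theorem continuous_rotatingTuple {n d : ℕ} (a b : Fin d) :
    Continuous (rotatingTuple n a b) := by
  refine continuous_pi fun i => ?_
  unfold rotatingTuple
  split_ifs <;> fun_prop

theorem rotatingTuple_injective {n d : ℕ} {a b : Fin d} (hab : a ≠ b) (t : ℝ) :
    Function.Injective (rotatingTuple n a b t) := by
  intro i j hij
  have ha := congrArg (fun v : EuclideanSpace ℝ (Fin d) => v a) hij
  have hb := congrArg (fun v : EuclideanSpace ℝ (Fin d) => v b) hij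
  have hcs := Real.sin_sq_add_cos_sq t
  have two_le {k : Fin n} (h₀ : (k : ℕ) ≠ 0) (h₁ : (k : ℕ) ≠ 1) : (2 : ℝ) ≤ (k : ℕ) := by
    exact_mod_cast (by omega : 2 ≤ (k : ℕ))
  apply Fin.ext
  simp only [rotatingTuple] at ha hb
  split_ifs at ha hb <;>
    simp [hab, hab.symm] at ha hb <;>
    first
    | omega
    | exact_mod_cast ha
    | nlinarith [two_le (k := i) (by assumption) (by assumption)]
    | nlinarith [two_le (k := j) (by assumption) (by assumption)]
    | nlinarith

/-- Half a turn exchanges the two rotating points. -/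
theorem rotatingTuple_pi {n d : ℕ} (hn : 2 ≤ n) (a b : Fin d) :
    rotatingTuple n a b Real.pi =
      rotatingTuple n a b 0 ∘ Equiv.swap ⟨0, by omega⟩ ⟨1, by omega⟩ := by
  funext i
  by_cases hi₀ : i = ⟨0, by omega⟩
  · subst hi₀
    simp [rotatingTuple]
  by_cases hi₁ : i = ⟨1, by omega⟩
  · subst hi₁
    simp [rotatingTuple]
  have h₀ : (i : ℕ) ≠ 0 := fun h => hi₀ (Fin.ext h)
  have h₁ : (i : ℕ) ≠ 1 := fun h => hi₁ (Fin.ext h)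
  simp [rotatingTuple, Equiv.swap_apply_of_ne_of_ne hi₀ hi₁, h₀, h₁]

/-- Even restricted to configurations of distinct points, the projection from the
ordered configuration space to the unordered configuration space admits no
continuous section. -/
theorem no_continuous_section_config (n d : ℕ) (hn : 2 ≤ n) (hd : 2 ≤ d) :
    ¬ ∃ s : Quotient (permSetoidInj n d) →
        {v : Fin n → EuclideanSpace ℝ (Fin d) // Function.Injective v},
        Continuous s ∧ ∀ q, Quotient.mk (permSetoidInj n d) (s q) = q := by
  rintro ⟨s, hs, hsec⟩
  let i₀ : Fin n := ⟨0, by omega⟩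
  let i₁ : Fin n := ⟨1, by omega⟩
  have hi : i₀ ≠ i₁ := by simp [i₀, i₁]
  have hab : (⟨0, by omega⟩ : Fin d) ≠ ⟨1, by omega⟩ := by simp
  let f : ℝ → {v : Fin n → EuclideanSpace ℝ (Fin d) // Function.Injective v} :=
    fun t => ⟨rotatingTuple n ⟨0, by omega⟩ ⟨1, by omega⟩ t, rotatingTuple_injective hab t⟩
  obtain ⟨σ, hσ⟩ := exists_perm_forall_section_eq hs hsec
    (f := f) ((continuous_rotatingTuple _ _).subtype_mk _)
  have hswap : (f Real.pi).1 = (f 0).1 ∘ Equiv.swap i₀ i₁ :=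
    rotatingTuple_pi hn _ _
  have hmk : Quotient.mk (permSetoidInj n d) (f 0) = Quotient.mk (permSetoidInj n d) (f Real.pi) :=
    Quotient.sound ⟨_, hswap⟩
  have heq : (f 0).1 ∘ σ = ((f 0).1 ∘ Equiv.swap i₀ i₁) ∘ σ := by
    rw [← hswap, ← hσ 0, ← hσ Real.pi, hmk]
  have h := (f 0).2 (congrFun heq (σ.symm i₀))
  simp only [Equiv.apply_symm_apply, Equiv.swap_apply_left] at h
  exact hi h
end
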